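/- Let S be a C-semigroup in ℕ^d with full cone, let ≺ be a term order on ℕ^d, assume PF'_≺(S) ≠ ∅ and f ≼ F(S)_≺ componentwise for all f ∈ PF'_≺(S). Then the following are equivalent: (a) S is ≺-almost symmetric; (b) Ω_≺ = S ∪ PF'_≺(S); (c) Ω_≺ + S* = S*; (d) |PF(S)| = |Ω_≺ \ S| + 1. -/

import Mathlib

open Set

/-- Membership in the rational cone spanned by `S` inside `ℚ^d`. -/
def memCone {d : ℕ} (S : Set (Fin d → ℕ)) (x : Fin d → ℚ) : Prop :=
  ∃ (n : ℕ) (c : Fin n → ℚ) (v : Fin n → (Fin d → ℕ)),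
    (∀ i, 0 ≤ c i) ∧ (∀ i, v i ∈ S) ∧ x = ∑ i, c i • (fun j => ((v i j : ℚ)))

/-- `cone(S) ∩ ℕ^d`, viewed as a subset of `ℕ^d`. -/
def coneN {d : ℕ} (S : Set (Fin d → ℕ)) : Set (Fin d → ℕ) :=
  {x | memCone S (fun j => ((x j : ℚ)))}

/-- `H(S) = (cone(S) \ S) ∩ ℕ^d`. -/
def Hset {d : ℕ} (S : Set (Fin d → ℕ)) : Set (Fin d → ℕ) := coneN S \ S

/-- The set of pseudo-Frobenius elements of `S`. -/
def pfSet {d : ℕ} (S : Set (Fin d → ℕ)) : Set (Fin d → ℕ) :=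
  {f | f ∈ Hset S ∧ ∀ s ∈ S, s ≠ 0 → f + s ∈ S}

/-- A term order on `ℕ^d`: a strict total order compatible with addition. -/
def IsTermOrder {d : ℕ} (prec : (Fin d → ℕ) → (Fin d → ℕ) → Prop) : Prop :=
  (∀ a, ¬ prec a a) ∧ (∀ a b c, prec a b → prec b c → prec a c) ∧
    (∀ a b, a ≠ b → prec a b ∨ prec b a) ∧
    (∀ a b c, prec a b → prec (a + c) (b + c))

/-- `F` is the maximum of `H(S)` with respect to the term order `prec`. -/
def IsFrob {d : ℕ} (S : Set (Fin d → ℕ)) (prec : (Fin d → ℕ) → (Fin d → ℕ) → Prop)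
    (F : Fin d → ℕ) : Prop :=
  F ∈ Hset S ∧ ∀ h ∈ Hset S, h ≠ F → prec h F

/-- A `C`-semigroup: a finitely generated submonoid of `ℕ^d` with
`H(S)` nonempty and finite. -/
def CSemigroup {d : ℕ} (S : AddSubmonoid (Fin d → ℕ)) : Prop :=
  S.FG ∧ (Hset (S : Set (Fin d → ℕ))).Nonempty ∧ (Hset (S : Set (Fin d → ℕ))).Finite

/-- `T` is an ideal of `S`: a subset of `cone(S) ∩ ℕ^d` with `S + T ⊆ T`. -/
def IsIdeal {d : ℕ} (S T : Set (Fin d → ℕ)) : Prop :=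
  T ⊆ coneN S ∧ ∀ s ∈ S, ∀ t ∈ T, s + t ∈ T

/-- `Ω_≺ = {z ∈ cone(S) ∩ ℕ^d : F(S)_≺ − z ∉ S}` (the condition `F − z ∉ S`
is expressed as: there is no `w ∈ S` with `z + w = F`). -/
def omegaSet {d : ℕ} (S : Set (Fin d → ℕ)) (F : Fin d → ℕ) : Set (Fin d → ℕ) :=
  {z ∈ coneN S | ¬ ∃ w ∈ S, z + w = F}

/-- `S` is `≺`-almost symmetric (with Frobenius element `F`):
`PF'(S) = PF(S) \ {F}` is nonempty and `F − g ∈ PF'(S)` for every `g ∈ PF'(S)`. -/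
def AlmostSym {d : ℕ} (S : Set (Fin d → ℕ)) (F : Fin d → ℕ) : Prop :=
  (pfSet S \ {F}).Nonempty ∧ ∀ g ∈ pfSet S \ {F}, ∃ w ∈ pfSet S \ {F}, g + w = F

/-- The unique minimal generating set of a submonoid of `ℕ^d`:
the nonzero elements that are not sums of two nonzero elements. -/
def minGens {d : ℕ} (S : Set (Fin d → ℕ)) : Set (Fin d → ℕ) :=
  {s ∈ S | s ≠ 0 ∧ ¬ ∃ x ∈ S, ∃ y ∈ S, x ≠ 0 ∧ y ≠ 0 ∧ x + y = s}

/-- With full cone, `pfSet S` consists of the elements outside `S` moved into `S` by every nonzero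
element of `S`. -/
theorem mem_pfSet_iff {d : ℕ} {S : Set (Fin d → ℕ)} (hfull : coneN S = Set.univ)
    {f : Fin d → ℕ} : f ∈ pfSet S ↔ f ∉ S ∧ ∀ s ∈ S, s ≠ 0 → f + s ∈ S := by
  simp [pfSet, Hset, hfull]

/-- With full cone, membership in `omegaSet S F` is the condition `F - z ∉ S`. -/
theorem mem_omegaSet_iff {d : ℕ} {S : Set (Fin d → ℕ)} (hfull : coneN S = Set.univ)
    {F z : Fin d → ℕ} : z ∈ omegaSet S F ↔ ∀ w ∈ S, z + w ≠ F := by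
  simp [omegaSet, hfull]

/-- If the complement of `S` is finite, every element outside `S` lies below a pseudo-Frobenius
element for the order induced by `S`. -/
theorem exists_add_mem_pfSet {d : ℕ} (S : AddSubmonoid (Fin d → ℕ))
    (hfin : (Hset (S : Set (Fin d → ℕ))).Finite)
    (hfull : coneN (S : Set (Fin d → ℕ)) = Set.univ) {x : Fin d → ℕ} (hx : x ∉ S) :
    ∃ s ∈ S, x + s ∈ pfSet (S : Set (Fin d → ℕ)) := by
  have hfin' : {s | s ∈ S ∧ x + s ∉ S}.Finite :=
    (hfin.preimage (f := fun s => x + s) (add_right_injective x).injOn).subset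
      fun s hs => ⟨hfull ▸ Set.mem_univ _, hs.2⟩
  obtain ⟨s, ⟨hsS, hxs⟩, hmax⟩ := hfin'.exists_maximal ⟨0, S.zero_mem, by simpa using hx⟩
  refine ⟨s, hsS, (mem_pfSet_iff hfull).2 ⟨hxs, fun t ht ht0 => ?_⟩⟩
  by_contra hn
  have hle : s + t ≤ s :=
    hmax ⟨S.add_mem hsS ht, by rwa [← add_assoc]⟩ le_self_add
  exact ht0 (by simpa using hle)

/-- A pseudo-Frobenius element other than `F` belongs to `omegaSet S F`. -/
theorem pfSet_sdiff_subset_omegaSet {d : ℕ} {S : Set (Fin d → ℕ)} (hfull : coneN S = Set.univ)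
    {F : Fin d → ℕ} (hF : F ∉ S) : pfSet S \ {F} ⊆ omegaSet S F := by
  rintro g ⟨hg, hgF⟩
  refine (mem_omegaSet_iff hfull).2 fun w hw h => ?_
  rcases eq_or_ne w 0 with rfl | hw0
  · exact hgF (by simpa using h)
  · exact hF (h ▸ ((mem_pfSet_iff hfull).1 hg).2 w hw hw0)

/-- `S` is contained in `omegaSet S F` when `F ∉ S`. -/
theorem subset_omegaSet {d : ℕ} (S : AddSubmonoid (Fin d → ℕ))
    (hfull : coneN (S : Set (Fin d → ℕ)) = Set.univ) {F : Fin d → ℕ} (hF : F ∉ S) :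
    (S : Set (Fin d → ℕ)) ⊆ omegaSet (S : Set (Fin d → ℕ)) F := fun _ hs =>
  (mem_omegaSet_iff hfull).2 fun _ hw h => hF (h ▸ S.add_mem hs hw)

/-- Let `S` be a `C`-semigroup with full cone, `PF'_≺(S) ≠ ∅`, and
`f ≼ F(S)_≺` for all `f ∈ PF'_≺(S)`. Then the following are equivalent:
(a) `S` is `≺`-almost symmetric; (b) `Ω_≺ = S ∪ PF'_≺(S)`;
(c) `Ω_≺ + S* = S*`; (d) `|PF(S)| = |Ω_≺ \ S| + 1`. -/
theorem almostSym_tfae {d : ℕ} (S : AddSubmonoid (Fin d → ℕ)) (hC : CSemigroup S)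
    (hfull : coneN (S : Set (Fin d → ℕ)) = Set.univ)
    (prec : (Fin d → ℕ) → (Fin d → ℕ) → Prop) (hprec : IsTermOrder prec)
    (F : Fin d → ℕ) (hF : IsFrob (S : Set (Fin d → ℕ)) prec F)
    (hne : (pfSet (S : Set (Fin d → ℕ)) \ {F}).Nonempty)
    (hle : ∀ f ∈ pfSet (S : Set (Fin d → ℕ)) \ {F}, f ≤ F) :
    (AlmostSym (S : Set (Fin d → ℕ)) F ↔
      omegaSet (S : Set (Fin d → ℕ)) F =
        (S : Set (Fin d → ℕ)) ∪ (pfSet (S : Set (Fin d → ℕ)) \ {F})) ∧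
    (omegaSet (S : Set (Fin d → ℕ)) F =
        (S : Set (Fin d → ℕ)) ∪ (pfSet (S : Set (Fin d → ℕ)) \ {F}) ↔
      {x | ∃ a ∈ omegaSet (S : Set (Fin d → ℕ)) F,
          ∃ b ∈ (S : Set (Fin d → ℕ)), b ≠ 0 ∧ x = a + b} =
        {s ∈ (S : Set (Fin d → ℕ)) | s ≠ 0}) ∧
    ({x | ∃ a ∈ omegaSet (S : Set (Fin d → ℕ)) F,
          ∃ b ∈ (S : Set (Fin d → ℕ)), b ≠ 0 ∧ x = a + b} =
        {s ∈ (S : Set (Fin d → ℕ)) | s ≠ 0} ↔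
      (pfSet (S : Set (Fin d → ℕ))).ncard =
        (omegaSet (S : Set (Fin d → ℕ)) F \ (S : Set (Fin d → ℕ))).ncard + 1) := by
  have hfin := hC.2.2
  have hFS : F ∉ S := hF.1.2
  have hSO := subset_omegaSet S hfull hFS
  have hPO := pfSet_sdiff_subset_omegaSet hfull (S := (S : Set (Fin d → ℕ))) hFS
  have hFPF : F ∈ pfSet (S : Set (Fin d → ℕ)) := by
    obtain ⟨s, -, hs⟩ := exists_add_mem_pfSet S hfin hfull hFS
    by_cases h : F + s = F
    · rwa [h] at hs
    · have hs0 : s = 0 := by simpa using hle _ ⟨hs, h⟩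
      exact absurd (by simp [hs0]) h
  have hFO : F ∉ omegaSet (S : Set (Fin d → ℕ)) F := fun h =>
    (mem_omegaSet_iff hfull).1 h 0 S.zero_mem (add_zero F)
  have hPD : pfSet (S : Set (Fin d → ℕ)) \ {F} ⊆
      omegaSet (S : Set (Fin d → ℕ)) F \ (S : Set (Fin d → ℕ)) :=
    fun g hg => ⟨hPO hg, hg.1.1.2⟩
  have hb : omegaSet (S : Set (Fin d → ℕ)) F =
      (S : Set (Fin d → ℕ)) ∪ (pfSet (S : Set (Fin d → ℕ)) \ {F}) ↔
      omegaSet (S : Set (Fin d → ℕ)) F \ (S : Set (Fin d → ℕ)) ⊆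
        pfSet (S : Set (Fin d → ℕ)) \ {F} := by
    rw [Set.sdiff_subset_iff]
    exact ⟨fun h => h.subset, fun h => h.antisymm (Set.union_subset hSO hPO)⟩
  have hac : AlmostSym (S : Set (Fin d → ℕ)) F ↔
      omegaSet (S : Set (Fin d → ℕ)) F \ (S : Set (Fin d → ℕ)) ⊆
        pfSet (S : Set (Fin d → ℕ)) \ {F} := by
    constructor
    · rintro ⟨-, hsym⟩ x ⟨hxO, hxS⟩
      obtain ⟨s, hsS, hs⟩ := exists_add_mem_pfSet S hfin hfull hxS
      have hxF := (mem_omegaSet_iff hfull).1 hxO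
      rcases eq_or_ne s 0 with rfl | hs0
      · exact ⟨by simpa using hs, fun h => hFO (h ▸ hxO)⟩
      · obtain ⟨w, hw, hsum⟩ := hsym _ ⟨hs, hxF s hsS⟩
        refine absurd ?_ (hxF (w + s) (((mem_pfSet_iff hfull).1 hw.1).2 s hsS hs0))
        rw [← hsum, add_assoc, add_comm w]
    · refine fun h => ⟨hne, fun g hg => ?_⟩
      have hsum : g + (F - g) = F := add_tsub_cancel_of_le (hle g hg)
      refine ⟨F - g, h ⟨(mem_omegaSet_iff hfull).2 fun w hw hwF => ?_, fun hS => ?_⟩, hsum⟩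
      · have hgw : w = g := add_left_cancel (hwF.trans ((add_comm _ _).trans hsum).symm)
        exact hg.1.1.2 (hgw ▸ hw)
      · exact (mem_omegaSet_iff hfull).1 (hPO hg) _ hS hsum
  have hcc : {x | ∃ a ∈ omegaSet (S : Set (Fin d → ℕ)) F,
      ∃ b ∈ (S : Set (Fin d → ℕ)), b ≠ 0 ∧ x = a + b} =
        {s ∈ (S : Set (Fin d → ℕ)) | s ≠ 0} ↔
      omegaSet (S : Set (Fin d → ℕ)) F \ (S : Set (Fin d → ℕ)) ⊆
        pfSet (S : Set (Fin d → ℕ)) \ {F} := by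
    constructor
    · rintro h x ⟨hxO, hxS⟩
      refine ⟨(mem_pfSet_iff hfull).2 ⟨hxS, fun s hs hs0 => ?_⟩, fun hx => hFO (hx ▸ hxO)⟩
      exact (h.subset ⟨x, hxO, s, hs, hs0, rfl⟩).1
    · intro h
      ext x
      constructor
      · rintro ⟨a, ha, b, hb, hb0, rfl⟩
        refine ⟨?_, fun h0 => hb0 (add_eq_zero.1 h0).2⟩
        by_cases haS : a ∈ S
        · exact S.add_mem haS hb
        · exact ((mem_pfSet_iff hfull).1 (h ⟨ha, haS⟩).1).2 b hb hb0
      · rintro ⟨hx, hx0⟩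
        exact ⟨0, hSO S.zero_mem, x, hx, hx0, (zero_add x).symm⟩
  have hdc : (pfSet (S : Set (Fin d → ℕ))).ncard =
        (omegaSet (S : Set (Fin d → ℕ)) F \ (S : Set (Fin d → ℕ))).ncard + 1 ↔
      omegaSet (S : Set (Fin d → ℕ)) F \ (S : Set (Fin d → ℕ)) ⊆
        pfSet (S : Set (Fin d → ℕ)) \ {F} := by
    have hPfin : (pfSet (S : Set (Fin d → ℕ))).Finite := hfin.subset fun _ hf => hf.1
    have hOfin : (omegaSet (S : Set (Fin d → ℕ)) F \ (S : Set (Fin d → ℕ))).Finite :=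
      hfin.subset fun _ hx => ⟨hx.1.1, hx.2⟩
    rw [← Set.ncard_sdiff_singleton_add_one hFPF hPfin, Nat.add_right_cancel_iff]
    exact ⟨fun h => (Set.eq_of_subset_of_ncard_le hPD h.ge hOfin).symm.subset,
      fun h => congrArg Set.ncard (hPD.antisymm h)⟩
  exact ⟨hac.trans hb.symm, hb.trans hcc.symm, hcc.trans hdc.symm⟩
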